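/- Let p be an ultrafilter on ℕ, let (x_i)_{i∈ℕ} be a bounded sequence in ℝ^d converging along p to a point x ∈ ℝ^d, and let h : ℝ^d × ℕ → ℝ be the restriction of a generalised polynomial ℝ^{d+1} → ℝ. Then there exist s ∈ ℕ, generalised polynomials g_1,…,g_s : ℕ → ℝ and real polynomials f_1,…,f_s in d variables such that for every n ∈ ℕ, for p-almost all i: h(x_i, n) = Σ_{j=1}^s g_j(n)·f_j(x_i − x). -/

import Mathlib

/-- Generalised polynomial maps `ℝ^d → ℝ`: the smallest family containing coordinate
maps and constants, closed under addition, multiplication and integer part. -/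
inductive IsGenPoly {d : ℕ} : ((Fin d → ℝ) → ℝ) → Prop
  | coord (i : Fin d) : IsGenPoly (fun x => x i)
  | const (c : ℝ) : IsGenPoly (fun _ => c)
  | add {f g : (Fin d → ℝ) → ℝ} : IsGenPoly f → IsGenPoly g →
      IsGenPoly (fun x => f x + g x)
  | mul {f g : (Fin d → ℝ) → ℝ} : IsGenPoly f → IsGenPoly g →
      IsGenPoly (fun x => f x * g x)
  | intPart {f : (Fin d → ℝ) → ℝ} : IsGenPoly f →
      IsGenPoly (fun x => (⌊f x⌋ : ℝ))

/-- A generalised polynomial on `ℕ`: the restriction to `ℕ` of a generalised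
polynomial `ℝ → ℝ`. -/
def IsGenPolyNat (g : ℕ → ℝ) : Prop :=
  ∃ f : (Fin 1 → ℝ) → ℝ, IsGenPoly f ∧ ∀ n : ℕ, g n = f (fun _ => (n : ℝ))

/-- A generalised polynomial subset of `ℕ`: the zero set of a generalised polynomial. -/
def IsGenPolySet (E : Set ℕ) : Prop :=
  ∃ g : ℕ → ℝ, IsGenPolyNat g ∧ E = {n : ℕ | g n = 0}

namespace IsGenPolyNat

theorem congr {f g : ℕ → ℝ} (hf : IsGenPolyNat f) (h : ∀ n, g n = f n) : IsGenPolyNat g :=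
  (funext h : g = f) ▸ hf

theorem const (c : ℝ) : IsGenPolyNat fun _ => c :=
  ⟨_, .const c, fun _ => rfl⟩

theorem natCast : IsGenPolyNat fun n => (n : ℝ) :=
  ⟨_, .coord 0, fun _ => rfl⟩

theorem add {f g : ℕ → ℝ} : IsGenPolyNat f → IsGenPolyNat g →
    IsGenPolyNat fun n => f n + g n := by
  rintro ⟨F, hF, hf⟩ ⟨G, hG, hg⟩
  exact ⟨_, hF.add hG, fun n => congrArg₂ _ (hf n) (hg n)⟩

theorem mul {f g : ℕ → ℝ} : IsGenPolyNat f → IsGenPolyNat g →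
    IsGenPolyNat fun n => f n * g n := by
  rintro ⟨F, hF, hf⟩ ⟨G, hG, hg⟩
  exact ⟨_, hF.mul hG, fun n => congrArg₂ _ (hf n) (hg n)⟩

theorem floor {f : ℕ → ℝ} : IsGenPolyNat f → IsGenPolyNat fun n => (⌊f n⌋ : ℝ) := by
  rintro ⟨F, hF, hf⟩
  exact ⟨_, hF.intPart, fun n => congrArg (fun r : ℝ => (⌊r⌋ : ℝ)) (hf n)⟩

theorem neg {f : ℕ → ℝ} (hf : IsGenPolyNat f) : IsGenPolyNat fun n => -f n :=
  ((const (-1)).mul hf).congr fun n => by ring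

theorem sub {f g : ℕ → ℝ} (hf : IsGenPolyNat f) (hg : IsGenPolyNat g) :
    IsGenPolyNat fun n => f n - g n :=
  (hf.add hg.neg).congr fun n => by ring

theorem fract {f : ℕ → ℝ} (hf : IsGenPolyNat f) : IsGenPolyNat fun n => Int.fract (f n) :=
  hf.sub hf.floor

theorem sum {ι : Type*} (s : Finset ι) {f : ι → ℕ → ℝ} (hf : ∀ j, IsGenPolyNat (f j)) :
    IsGenPolyNat fun n => ∑ j ∈ s, f j n := by
  classical
  induction s using Finset.induction_on with
  | empty => exact (const 0).congr fun n => by simp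
  | insert a s ha ih => exact ((hf a).add ih).congr fun n => Finset.sum_insert ha

/-- For irrational `c`, the number `⌊c * m⌋ + ⌊-(c * m)⌋ + 1` is the indicator of `m = 0`
among integers `m`. -/
theorem indicator_intCast_eq_zero {m : ℕ → ℤ} (hm : IsGenPolyNat fun n => (m n : ℝ)) :
    IsGenPolyNat fun n => if m n = 0 then 1 else 0 := by
  have h := (const √2).mul hm
  refine ((h.floor.add h.neg.floor).add (const 1)).congr fun n => ?_
  split_ifs with h0
  · simp [h0]
  · have hirr : Irrational (√2 * m n) := irrational_sqrt_two.mul_intCast h0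
    rw [Int.floor_neg, Int.ceil_eq_floor_add_one_iff_notMem _ |>.2]
    · push_cast; ring
    · rintro ⟨k, hk⟩
      exact hirr ⟨k, by simpa using hk⟩

/-- The negativity indicator of a bounded function `f` is obtained from `⌊f / C⌋` for large `C`. -/
theorem indicator_neg_of_bounded {f : ℕ → ℝ} (hf : IsGenPolyNat f) {C : ℝ}
    (hC : ∀ n, |f n| ≤ C) : IsGenPolyNat fun n => if f n < 0 then 1 else 0 := by
  have hC0 : 0 ≤ C := (abs_nonneg _).trans (hC 0)
  have hpos : 0 < C + 1 := by linarith
  refine (((const (C + 1)⁻¹).mul hf).floor.neg).congr fun n => ?_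
  obtain ⟨h1, h2⟩ := abs_le.1 (hC n)
  have e : (C + 1)⁻¹ * f n = f n / (C + 1) := by ring
  split_ifs with h
  · have : ⌊(C + 1)⁻¹ * f n⌋ = -1 := by
      rw [e, Int.floor_eq_iff]
      push_cast
      rw [le_div_iff₀ hpos, neg_add_cancel, div_lt_iff₀ hpos]
      constructor <;> linarith
    rw [this]; norm_num
  · have : ⌊(C + 1)⁻¹ * f n⌋ = 0 := by
      rw [e, Int.floor_eq_zero_iff]
      refine ⟨div_nonneg (not_lt.1 h) hpos.le, ?_⟩
      rw [div_lt_iff₀ hpos]; linarith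
    rw [this]; norm_num

end IsGenPolyNat

/-- Polynomials in `n + 1` whose coefficients are bounded generalised polynomials on `ℕ`,
built up by Horner's scheme. -/
inductive IsHornerPoly : (ℕ → ℝ) → Prop
  | bounded {b : ℕ → ℝ} (C : ℝ) : IsGenPolyNat b → (∀ n, |b n| ≤ C) → IsHornerPoly b
  | step {u b : ℕ → ℝ} (C : ℝ) : IsHornerPoly u → IsGenPolyNat b → (∀ n, |b n| ≤ C) →
      IsHornerPoly fun n => ((n : ℝ) + 1) * u n + b n

namespace IsHornerPoly

theorem congr {f g : ℕ → ℝ} (hf : IsHornerPoly f) (h : ∀ n, g n = f n) : IsHornerPoly g :=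
  (funext h : g = f) ▸ hf

theorem const (c : ℝ) : IsHornerPoly fun _ => c :=
  bounded |c| (.const c) fun _ => le_rfl

theorem succ_mul {f : ℕ → ℝ} (hf : IsHornerPoly f) :
    IsHornerPoly fun n => ((n : ℝ) + 1) * f n :=
  (step 0 hf (.const 0) fun _ => by simp).congr fun n => by ring

theorem natCast : IsHornerPoly fun n => (n : ℝ) :=
  (step 1 (const 1) (.const (-1)) fun _ => by simp).congr fun n => by ring

theorem add_bounded {f b : ℕ → ℝ} {C : ℝ} (hf : IsHornerPoly f) (hb : IsGenPolyNat b)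
    (hC : ∀ n, |b n| ≤ C) : IsHornerPoly fun n => f n + b n := by
  cases hf with
  | bounded D ha hD =>
    exact bounded (D + C) (ha.add hb) fun n => (abs_add_le _ _).trans (add_le_add (hD n) (hC n))
  | step D hu ha hD =>
    exact (step (D + C) hu (ha.add hb) fun n =>
      (abs_add_le _ _).trans (add_le_add (hD n) (hC n))).congr fun n => by ring

theorem add {f g : ℕ → ℝ} (hf : IsHornerPoly f) (hg : IsHornerPoly g) :
    IsHornerPoly fun n => f n + g n := by
  induction hf generalizing g with
  | bounded C hb hC => exact (hg.add_bounded hb hC).congr fun n => by ring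
  | step C hu hb hC ih =>
    cases hg with
    | bounded D ha hD =>
      exact ((step C hu hb hC).add_bounded ha hD)
    | step D hv ha hD =>
      exact (((ih hv).succ_mul.add_bounded hb hC).add_bounded ha hD).congr fun n => by ring

theorem bounded_mul {f b : ℕ → ℝ} {C : ℝ} (hf : IsHornerPoly f) (hb : IsGenPolyNat b)
    (hC : ∀ n, |b n| ≤ C) : IsHornerPoly fun n => b n * f n := by
  have hmul {a : ℕ → ℝ} {D : ℝ} (hD : ∀ n, |a n| ≤ D) (n : ℕ) : |b n * a n| ≤ C * D := by
    rw [abs_mul]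
    exact mul_le_mul (hC n) (hD n) (abs_nonneg _) ((abs_nonneg _).trans (hC n))
  induction hf with
  | bounded D ha hD => exact bounded (C * D) (hb.mul ha) (hmul hD)
  | step D hu ha hD ih =>
    exact (step (C * D) ih (hb.mul ha) (hmul hD)).congr fun n => by ring

theorem mul {f g : ℕ → ℝ} (hf : IsHornerPoly f) (hg : IsHornerPoly g) :
    IsHornerPoly fun n => f n * g n := by
  induction hf with
  | bounded C hb hC => exact hg.bounded_mul hb hC
  | step C hu hb hC ih =>
    exact (ih.succ_mul.add (hg.bounded_mul hb hC)).congr fun n => by ring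

theorem isGenPolyNat {f : ℕ → ℝ} (hf : IsHornerPoly f) : IsGenPolyNat f := by
  induction hf with
  | bounded C hb hC => exact hb
  | step C hu hb hC ih => exact ((IsGenPolyNat.natCast.add (.const 1)).mul ih).add hb

/-- Where `|(n + 1) * u n|` exceeds the bound of `b`, the sign of `(n + 1) * u n + b n` is that of
`u n`; elsewhere the function is bounded. -/
theorem indicator_neg {f : ℕ → ℝ} (hf : IsHornerPoly f) :
    IsGenPolyNat fun n => if f n < 0 then 1 else 0 := by
  induction hf with
  | bounded C hb hC => exact hb.indicator_neg_of_bounded hC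
  | @step u b C hu hb hC ih =>
    have hC0 : 0 ≤ C := (abs_nonneg _).trans (hC 0)
    have hpos : 0 < C + 1 := by linarith
    have hv := (IsGenPolyNat.natCast.add (.const 1)).mul hu.isGenPolyNat
    have hm := ((IsGenPolyNat.const (C + 1)⁻¹).mul hv).floor
    set m : ℕ → ℤ := fun n => ⌊(C + 1)⁻¹ * (((n : ℝ) + 1) * u n)⌋ with hmdef
    have hE := IsGenPolyNat.indicator_intCast_eq_zero (m := fun n => m n * (m n + 1))
      ((hm.mul (hm.add (.const 1))).congr fun n => by push_cast; rfl)
    have hsmall (n : ℕ) (h : m n * (m n + 1) = 0) : |((n : ℝ) + 1) * u n| ≤ C + 1 := by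
      have hle := Int.floor_le ((C + 1)⁻¹ * (((n : ℝ) + 1) * u n))
      have hlt := Int.lt_floor_add_one ((C + 1)⁻¹ * (((n : ℝ) + 1) * u n))
      change (m n : ℝ) ≤ _ at hle
      change _ < (m n : ℝ) + 1 at hlt
      rw [inv_mul_eq_div] at hle hlt
      rw [le_div_iff₀ hpos] at hle
      rw [div_lt_iff₀ hpos] at hlt
      rcases mul_eq_zero.1 h with h | h
      · rw [h] at hle hlt
        push_cast at hle hlt
        rw [abs_le]
        constructor <;> linarith
      · rw [eq_neg_of_add_eq_zero_left h] at hle hlt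
        push_cast at hle hlt
        rw [abs_le]
        constructor <;> linarith
    have hlarge (n : ℕ) (h : m n * (m n + 1) ≠ 0) : C + 1 ≤ |((n : ℝ) + 1) * u n| := by
      by_contra! hlt
      rw [abs_lt] at hlt
      apply h
      rcases le_or_gt 0 (((n : ℝ) + 1) * u n) with h0 | h0
      · have : m n = 0 := by
          rw [hmdef, Int.floor_eq_zero_iff, inv_mul_eq_div]
          exact ⟨div_nonneg h0 hpos.le, (div_lt_one hpos).2 hlt.2⟩
        simp [this]
      · have : m n = -1 := by
          rw [hmdef, Int.floor_eq_iff, inv_mul_eq_div]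
          push_cast
          rw [le_div_iff₀ hpos, neg_add_cancel, div_lt_iff₀ hpos]
          constructor <;> linarith
        simp [this]
    have hbdd := (hE.mul (hv.add hb)).indicator_neg_of_bounded (C := C + 1 + C) fun n => by
      split_ifs with h
      · rw [one_mul]
        exact (abs_add_le _ _).trans (add_le_add (hsmall n h) (hC n))
      · simp only [zero_mul, abs_zero]; linarith
    refine (hbdd.add (((IsGenPolyNat.const 1).sub hE).mul ih)).congr fun n => ?_
    by_cases h : m n * (m n + 1) = 0
    · simp [h]
    · have hl := hlarge n h
      obtain ⟨h1, h2⟩ := abs_le.1 (hC n)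
      have hn : (0 : ℝ) < (n : ℝ) + 1 := by positivity
      have hiff : ((n : ℝ) + 1) * u n + b n < 0 ↔ u n < 0 := by
        constructor
        · intro h3
          by_contra! h4
          rw [abs_of_nonneg (by positivity)] at hl
          linarith
        · intro h3
          rw [abs_of_neg (mul_neg_of_pos_of_neg hn h3)] at hl
          linarith
      simp [h, hiff]

end IsHornerPoly

namespace IsGenPolyNat

theorem isHornerPoly {g : ℕ → ℝ} (hg : IsGenPolyNat g) : IsHornerPoly g := by
  obtain ⟨f, hf, h⟩ := hg
  refine IsHornerPoly.congr ?_ h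
  clear h
  induction hf with
  | coord i => exact .natCast
  | const c => exact .const c
  | add _ _ hf hg => exact hf.add hg
  | mul _ _ hf hg => exact hf.mul hg
  | intPart _ hf =>
    refine (hf.add_bounded hf.isGenPolyNat.fract.neg (C := 1) fun n => ?_).congr fun n => ?_
    · rw [abs_neg, Int.abs_fract]
      exact (Int.fract_lt_one _).le
    · rw [Int.fract]; ring

theorem indicator_neg {g : ℕ → ℝ} (hg : IsGenPolyNat g) :
    IsGenPolyNat fun n => if g n < 0 then 1 else 0 :=
  hg.isHornerPoly.indicator_neg

open Classical in
theorem indicator_eq_zero {g : ℕ → ℝ} (hg : IsGenPolyNat g) :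
    IsGenPolyNat fun n => if g n = 0 then 1 else 0 := by
  refine (((const 1).sub hg.indicator_neg).sub hg.neg.indicator_neg).congr fun n => ?_
  rcases lt_trichotomy (g n) 0 with h | h | h
  · simp [h, h.ne, h.le]
  · simp [h]
  · simp [h, h.ne', h.le]

end IsGenPolyNat

open Filter Topology

theorem Ultrafilter.exists_eventually_forall_abs_le {α : Type*} (p : Ultrafilter α) {s : ℕ}
    (y : Fin (s + 1) → α → ℝ) : ∃ j, ∀ᶠ i in p, ∀ k, |y k i| ≤ |y j i| := by
  have h : ∀ᶠ i in p, ∃ j, ∀ k, |y k i| ≤ |y j i| :=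
    .of_forall fun i => Finite.exists_max fun k => |y k i|
  exact Ultrafilter.eventually_exists_iff.1 h

theorem Ultrafilter.exists_tendsto_of_eventually_abs_le {α : Type*} (p : Ultrafilter α)
    {u : α → ℝ} {C : ℝ} (h : ∀ᶠ i in p, |u i| ≤ C) : ∃ c, Tendsto u p (𝓝 c) := by
  obtain ⟨c, -, hc⟩ := (isCompact_Icc (a := -C) (b := C)).ultrafilter_le_nhds (p.map u)
    (le_principal_iff.2 (h.mono fun i hi => abs_le.1 hi))
  exact ⟨c, hc⟩

open Classical in
/-- The sign along `p` of a linear combination of functions is decided lexicographically, starting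
from the function of dominant size. -/
theorem IsGenPolyNat.indicator_eventually_sum_neg {α : Type*} (p : Ultrafilter α) {s : ℕ}
    (g : Fin s → ℕ → ℝ) (hg : ∀ j, IsGenPolyNat (g j)) (y : Fin s → α → ℝ) :
    IsGenPolyNat fun n => if ∀ᶠ i in p, ∑ j, g j n * y j i < 0 then 1 else 0 := by
  induction s with
  | zero => exact (const 0).congr fun n => by simp [p.neBot.ne]
  | succ s ih =>
    obtain ⟨j, hj⟩ := p.exists_eventually_forall_abs_le y
    rcases p.em (fun i => y j i = 0) with h0 | h0
    · refine (const 0).congr fun n => if_neg fun h => ?_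
      obtain ⟨i, h1, h2, h3⟩ := (hj.and (h0.and h)).exists
      have hz (k) : y k i = 0 := by simpa [h2] using h1 k
      simp [hz] at h3
    have hlim (k) : ∃ c, Tendsto (fun i => y k i / y j i) p (𝓝 c) := by
      refine p.exists_tendsto_of_eventually_abs_le (C := 1) (hj.mono fun i hi => ?_)
      rw [abs_div]
      exact div_le_one_of_le₀ (hi k) (abs_nonneg _)
    choose c hc using hlim
    have ha : IsGenPolyNat fun n => ∑ k, g k n * c k := sum _ fun k => (hg k).mul (const (c k))
    have hcj : c j = 1 := tendsto_nhds_unique (hc j)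
      (tendsto_const_nhds.congr' (h0.mono fun i hi => (div_self hi).symm))
    have hsplit (n : ℕ) (i : α) : ∑ k, g k n * y k i = (∑ k, g k n * c k) * y j i +
        ∑ k, g (j.succAbove k) n * (y (j.succAbove k) i - c (j.succAbove k) * y j i) := by
      simp only [Fin.sum_univ_succAbove _ j, hcj, mul_sub, Finset.sum_sub_distrib, add_mul,
        Finset.sum_mul]
      simp only [mul_assoc]
      ring
    have hratio (n : ℕ) : Tendsto (fun i => (∑ k, g k n * y k i) / y j i) p
        (𝓝 (∑ k, g k n * c k)) := by
      simp only [Finset.sum_div, mul_div_assoc]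
      exact tendsto_finsetSum _ fun k _ => (hc k).const_mul _
    have hN := ih (fun k => g (j.succAbove k)) (fun k => hg _)
      fun k i => y (j.succAbove k) i - c (j.succAbove k) * y j i
    have hsign : ∃ σ : ℝ, σ ≠ 0 ∧ ∀ᶠ i in p, 0 < σ * y j i := by
      rcases p.em (fun i => 0 < y j i) with h | h
      · exact ⟨1, one_ne_zero, h.mono fun i hi => by simpa using hi⟩
      · refine ⟨-1, by norm_num, (h.and h0).mono fun i hi => ?_⟩
        have := lt_of_le_of_ne (not_lt.1 hi.1) hi.2
        linarith
    obtain ⟨σ, hσ0, hσ⟩ := hsign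
    refine ((ha.indicator_eq_zero.mul hN).add ((const σ).mul ha).indicator_neg).congr fun n => ?_
    rcases eq_or_ne (∑ k, g k n * c k) 0 with h | h
    · simp [hsplit, h]
    · have key : (∀ᶠ i in p, ∑ k, g k n * y k i < 0) ↔ σ * ∑ k, g k n * c k < 0 := by
        have hlt : ∀ᶠ i in p, 0 < (∑ k, g k n * y k i) / y j i * ∑ k, g k n * c k :=
          ((hratio n).mul_const _).eventually_const_lt (mul_self_pos.2 h)
        have hiff : ∀ᶠ i in p, (∑ k, g k n * y k i < 0 ↔ σ * ∑ k, g k n * c k < 0) := by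
          filter_upwards [hlt, hσ] with i h1 h2
          have hy : y j i ≠ 0 := fun h => by simp [h] at h2
          have h3 : 0 < (∑ k, g k n * y k i) * (σ * ∑ k, g k n * c k) := by
            calc
              0 < _ := mul_pos h1 h2
              _ = _ := by field_simp
          exact neg_iff_neg_of_mul_pos h3
        rw [Filter.eventually_congr hiff, Filter.eventually_const]
      simp [key, h]

open Classical in
theorem eventually_floor_eq_of_tendsto {α : Type*} (p : Ultrafilter α) {u : α → ℝ} {a : ℝ}
    (h : Tendsto u p (𝓝 a)) : ∀ᶠ i in p, (⌊u i⌋ : ℝ) = ⌊a⌋ -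
      (if Int.fract a = 0 then 1 else 0) * (if ∀ᶠ i in p, u i - a < 0 then 1 else 0) := by
  by_cases ha : Int.fract a = 0
  · have hfl : (⌊a⌋ : ℝ) = a := by rw [Int.fract] at ha; linarith
    by_cases hneg : ∀ᶠ i in p, u i - a < 0
    · filter_upwards [hneg, h.eventually_const_lt (sub_one_lt a)] with i h1 h2
      have : ⌊u i⌋ = ⌊a⌋ - 1 := by
        rw [Int.floor_eq_iff]
        push_cast
        constructor <;> linarith
      rw [if_pos ha, if_pos hneg, this]
      push_cast; ring
    · filter_upwards [Ultrafilter.eventually_not.2 hneg, h.eventually_lt_const (lt_add_one a)]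
        with i h1 h2
      have : ⌊u i⌋ = ⌊a⌋ := by
        rw [Int.floor_eq_iff]
        constructor <;> linarith
      rw [if_neg hneg, this, mul_zero, sub_zero]
  · have hlt : (⌊a⌋ : ℝ) < a := by
      have := lt_of_le_of_ne (Int.fract_nonneg a) (Ne.symm ha)
      rw [Int.fract] at this
      linarith
    filter_upwards [h.eventually_const_lt hlt, h.eventually_lt_const (Int.lt_floor_add_one a)]
      with i h1 h2
    have : ⌊u i⌋ = ⌊a⌋ := Int.floor_eq_iff.2 ⟨h1.le, h2⟩
    simp [this, ha]

/-- Let `p` be an ultrafilter on `ℕ`, `(x_i)` a bounded sequence in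
`ℝ^d` converging to `xlim` along `p`, and `h(x,n) = H(x,n)` the restriction of a
generalised polynomial `ℝ^{d+1} → ℝ`. Then there are generalised polynomials
`g_1,…,g_s : ℕ → ℝ` and polynomials `f_1,…,f_s` in `d` variables with
`h(x_i,n) = Σ_j g_j(n)·f_j(x_i − xlim)` for every `n` and `p`-almost all `i`. -/
theorem genPoly_family_expansion (d : ℕ) (p : Ultrafilter ℕ)
    (x : ℕ → (Fin d → ℝ)) (xlim : Fin d → ℝ)
    (hxb : ∃ C : ℝ, ∀ i, ‖x i‖ ≤ C)
    (hxlim : Filter.Tendsto x ↑p (nhds xlim))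
    (H : (Fin (d + 1) → ℝ) → ℝ) (hH : IsGenPoly H) :
    ∃ (s : ℕ) (g : Fin s → ℕ → ℝ) (f : Fin s → MvPolynomial (Fin d) ℝ),
      (∀ j, IsGenPolyNat (g j)) ∧
      ∀ n : ℕ, ∀ᶠ i in ↑p,
        H (Fin.snoc (x i) (n : ℝ)) =
          ∑ j, g j n * MvPolynomial.eval (fun t => x i t - xlim t) (f j) := by
  have single (F : (Fin (d + 1) → ℝ) → ℝ) {g : ℕ → ℝ} (hg : IsGenPolyNat g)
      (f : MvPolynomial (Fin d) ℝ) (h : ∀ n : ℕ, ∀ᶠ i in p,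
        F (Fin.snoc (x i) (n : ℝ)) = g n * MvPolynomial.eval (fun t => x i t - xlim t) f) :
      ∃ (s : ℕ) (g : Fin s → ℕ → ℝ) (f : Fin s → MvPolynomial (Fin d) ℝ),
        (∀ j, IsGenPolyNat (g j)) ∧ ∀ n : ℕ, ∀ᶠ i in p, F (Fin.snoc (x i) (n : ℝ)) =
          ∑ j, g j n * MvPolynomial.eval (fun t => x i t - xlim t) (f j) :=
    ⟨1, fun _ => g, fun _ => f, fun _ => hg, fun n => (h n).mono fun i hi => by simpa using hi⟩
  induction hH with
  | coord t =>
    induction t using Fin.lastCases with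
    | last => exact single (fun x => x (Fin.last d)) .natCast 1 fun n => .of_forall fun i => by simp
    | cast t =>
      exact single (fun x => x t.castSucc) (.const 1) (.X t + .C (xlim t)) fun n => .of_forall fun i => by simp
  | const c => exact single (fun _ => c) (.const c) 1 fun n => .of_forall fun i => by simp
  | add _ _ hF hG =>
    obtain ⟨s, g, f, hg, h⟩ := hF
    obtain ⟨s', g', f', hg', h'⟩ := hG
    refine ⟨s + s', Fin.append g g', Fin.append f f', fun j => ?_, fun n => ?_⟩
    · induction j using Fin.addCases <;> simp [hg, hg']
    · filter_upwards [h n, h' n] with i h1 h2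
      simp [Fin.sum_univ_add, h1, h2]
  | mul _ _ hF hG =>
    obtain ⟨s, g, f, hg, h⟩ := hF
    obtain ⟨s', g', f', hg', h'⟩ := hG
    let e := finProdFinEquiv (m := s) (n := s')
    refine ⟨s * s', fun j n => g (e.symm j).1 n * g' (e.symm j).2 n,
      fun j => f (e.symm j).1 * f' (e.symm j).2, fun j => (hg _).mul (hg' _), fun n => ?_⟩
    filter_upwards [h n, h' n] with i h1 h2
    rw [h1, h2, Finset.sum_mul_sum, ← Fintype.sum_prod_type', ← e.symm.sum_comp]
    refine Finset.sum_congr rfl fun j _ => ?_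
    rw [map_mul]
    ring
  | @intPart F _ hF =>
    obtain ⟨s, g, f, hg, h⟩ := hF
    have hlim (j) : Tendsto (fun i => MvPolynomial.eval (fun t => x i t - xlim t) (f j)) p
        (𝓝 (MvPolynomial.eval 0 (f j))) := by
      refine ((MvPolynomial.continuous_eval (f j)).tendsto 0).comp ?_
      simpa [Pi.sub_def] using hxlim.sub_const xlim
    have hG : IsGenPolyNat fun n => ∑ j, g j n * MvPolynomial.eval 0 (f j) :=
      .sum _ fun j => (hg j).mul (.const _)
    refine single (fun x => ⌊F x⌋) (hG.floor.sub (hG.fract.indicator_eq_zero.mul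
      (.indicator_eventually_sum_neg p g hg fun j i =>
        MvPolynomial.eval (fun t => x i t - xlim t) (f j) - MvPolynomial.eval 0 (f j)))) 1
      fun n => ?_
    filter_upwards [h n, eventually_floor_eq_of_tendsto p
      (tendsto_finsetSum Finset.univ fun j _ => (hlim j).const_mul (g j n))] with i h1 h2
    simp only [h1, h2, map_one, mul_one]
    congr! 6
    simp only [mul_sub, Finset.sum_sub_distrib]
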